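/- arXiv:1204.0289 — 3 statements merged into one kernel-verified Lean document; each statement's English description precedes it below -/
import Mathlib

section
/- For probability measures μ, ν, ρ on ℝ, the subordination distribution is additive in its first argument with respect to free convolution: (μ ⊞ ν) ⊳ ρ = (μ ⊳ ρ) ⊞ (ν ⊳ ρ). -/
open MeasureTheory Complex

noncomputable section

/-- The Cauchy transform `G_μ(z) = ∫ 1/(z - x) dμ(x)` of a measure on `ℝ`. -/
def cauchyG (μ : Measure ℝ) (z : ℂ) : ℂ := ∫ x : ℝ, (z - (x : ℂ))⁻¹ ∂μ

/-- The F-transform `F_μ = 1/G_μ`. -/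
def Ftr (μ : Measure ℝ) (z : ℂ) : ℂ := (cauchyG μ z)⁻¹

/-- The open upper half-plane `ℂ⁺`. -/
def UHP : Set ℂ := {z : ℂ | 0 < z.im}

/-- The truncated cone `Γ_{α,M} = {z ∈ ℂ⁺ : |Re z| < α · Im z, Im z > M}`. -/
def tcone (α M : ℝ) : Set ℂ := {z : ℂ | |z.re| < α * z.im ∧ M < z.im}

/-- `φ` is a Voiculescu transform of `μ`: `φ(F_μ(z)) + F_μ(z) = z` on some truncated cone. -/
def IsVT (μ : Measure ℝ) (φ : ℂ → ℂ) : Prop :=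
  ∃ α M : ℝ, 0 < α ∧ 0 < M ∧ ∀ z ∈ tcone α M, φ (Ftr μ z) + Ftr μ z = z

/-- `ψ` is a two-state Voiculescu transform of the pair `(μt, μ)`:
`ψ(F_μ(z)) + F_{μt}(z) = z` on some truncated cone. -/
def IsTwoStateVT (μt μ : Measure ℝ) (ψ : ℂ → ℂ) : Prop :=
  ∃ α M : ℝ, 0 < α ∧ 0 < M ∧ ∀ z ∈ tcone α M, ψ (Ftr μ z) + Ftr μt z = z

/-- `μ` is freely infinitely divisible: some Voiculescu transform `φ` of `μ` is such that
`t·φ` is a Voiculescu transform of a probability measure for every `t ≥ 0`. -/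
def IsFID (μ : Measure ℝ) : Prop :=
  ∃ φ : ℂ → ℂ, IsVT μ φ ∧ ∀ t : ℝ, 0 ≤ t →
    ∃ ν : Measure ℝ, IsProbabilityMeasure ν ∧ IsVT ν (fun z => (t : ℂ) * φ z)

/-- The semicircular distribution with mean `β` and variance `γ` (Dirac mass at `β` for `γ = 0`). -/
def semicircle (β γ : ℝ) : Measure ℝ :=
  if γ = 0 then Measure.dirac β
  else volume.withDensity
    (fun x => ENNReal.ofReal ((2 * Real.pi * γ)⁻¹ * Real.sqrt (4 * γ - (x - β) ^ 2)))

lemma norm_inv_sub_ofReal_le {z : ℂ} (hz : 0 < z.im) (x : ℝ) :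
    ‖(z - (x : ℂ))⁻¹‖ ≤ z.im⁻¹ := by
  rw [norm_inv]
  refine inv_anti₀ hz ?_
  have h := Complex.abs_im_le_norm (z - (x : ℂ))
  simp only [Complex.sub_im, Complex.ofReal_im, sub_zero] at h
  exact (le_abs_self _).trans h

lemma norm_le_of_abs_re_le {α : ℝ} {z : ℂ} (hz : 0 < z.im) (hre : |z.re| ≤ α * z.im) :
    ‖z‖ ≤ (1 + α) * z.im := by
  have h := Complex.norm_le_abs_re_add_abs_im z
  rw [abs_of_pos hz] at h
  linarith

/-- `z G_s(z) → 1` as `z → ∞` nontangentially. -/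
lemma tendsto_mul_cauchyG (s : Measure ℝ) [IsProbabilityMeasure s] (α : ℝ) :
    Filter.Tendsto (fun z : ℂ => z * cauchyG s z)
      (Filter.comap Complex.im Filter.atTop ⊓ Filter.principal {z : ℂ | |z.re| ≤ α * z.im})
      (nhds 1) := by
  set l := Filter.comap Complex.im Filter.atTop ⊓
    Filter.principal {z : ℂ | |z.re| ≤ α * z.im} with hl
  have him : Filter.Tendsto Complex.im l Filter.atTop :=
    Filter.tendsto_comap.mono_left inf_le_left
  have hpos : ∀ᶠ z in l, 0 < z.im := him.eventually_gt_atTop 0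
  have hcone : ∀ᶠ z in l, |z.re| ≤ α * z.im :=
    Filter.mem_inf_of_right (Filter.mem_principal_self _)
  have key : Filter.Tendsto (fun z : ℂ => ∫ x : ℝ, z * (z - (x : ℂ))⁻¹ ∂s) l
      (nhds (∫ _ : ℝ, (1 : ℂ) ∂s)) := by
    refine tendsto_integral_filter_of_dominated_convergence (fun _ => 1 + α) ?_ ?_
      (integrable_const _) ?_
    · exact Filter.Eventually.of_forall fun z => by
        apply Measurable.aestronglyMeasurable
        fun_prop
    · filter_upwards [hpos, hcone] with z hz hre
      refine Filter.Eventually.of_forall fun x => ?_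
      calc ‖z * (z - (x : ℂ))⁻¹‖ = ‖z‖ * ‖(z - (x : ℂ))⁻¹‖ := norm_mul _ _
        _ ≤ ((1 + α) * z.im) * z.im⁻¹ :=
          mul_le_mul (norm_le_of_abs_re_le hz hre) (norm_inv_sub_ofReal_le hz x)
            (norm_nonneg _) ((norm_nonneg z).trans (norm_le_of_abs_re_le hz hre))
        _ = 1 + α := by field_simp
    · refine Filter.Eventually.of_forall fun x => ?_
      rw [tendsto_iff_norm_sub_tendsto_zero]
      have hlim : Filter.Tendsto (fun z : ℂ => |x| * z.im⁻¹) l (nhds 0) := by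
        simpa using (tendsto_inv_atTop_zero.comp him).const_mul |x|
      refine squeeze_zero' (Filter.Eventually.of_forall fun _ => norm_nonneg _) ?_ hlim
      filter_upwards [hpos] with z hz
      have hne : z - (x : ℂ) ≠ 0 := by
        intro h
        have := congrArg Complex.im h
        simp at this
        exact hz.ne' this
      have heq : z * (z - (x : ℂ))⁻¹ - 1 = x * (z - (x : ℂ))⁻¹ := by
        field_simp
        ring
      rw [heq, norm_mul, Complex.norm_real, Real.norm_eq_abs]
      exact mul_le_mul_of_nonneg_left (norm_inv_sub_ofReal_le hz x) (abs_nonneg x)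
  simpa [cauchyG, integral_const_mul] using key

/-- `F_s(z) / z → 1` nontangentially, so `F_s` maps some truncated cone into any given one. -/
lemma exists_tcone_mapsTo (s : Measure ℝ) [IsProbabilityMeasure s] {α M : ℝ} (hα : 0 < α)
    (hM : 0 < M) :
    ∃ β N : ℝ, 0 < β ∧ 0 < N ∧ Set.MapsTo (Ftr s) (tcone β N) (tcone α M) := by
  have hlim := (tendsto_mul_cauchyG s (α / 2)).inv₀ one_ne_zero
  rw [inv_one] at hlim
  set δ : ℝ := α / (4 * (1 + α)) with hδ
  have hδpos : 0 < δ := by positivity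
  have hδα : δ * (1 + α) = α / 4 := by
    rw [hδ]
    field_simp
  have hev := hlim.eventually
    (Metric.ball_mem_nhds (1 : ℂ) (show 0 < δ / (1 + α / 2) by positivity))
  rw [Filter.eventually_inf_principal, Filter.eventually_comap] at hev
  obtain ⟨N, hN⟩ := Filter.eventually_atTop.1 hev
  refine ⟨α / 2, max N (2 * M), by positivity, lt_max_of_lt_right (by positivity), ?_⟩
  rintro z ⟨hre, him⟩
  have hNz : N ≤ z.im := (le_max_left _ _).trans him.le
  have hMz : 2 * M < z.im := (le_max_right _ _).trans_lt him
  have hz : 0 < z.im := by linarith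
  have hz0 : z ≠ 0 := by
    rintro rfl
    simp at hz
  have hball := hN z.im hNz z rfl hre.le
  rw [dist_eq_norm] at hball
  have hclose : ‖Ftr s z - z‖ ≤ δ * z.im := by
    have heq : Ftr s z - z = ((z * cauchyG s z)⁻¹ - 1) * z := by
      rw [Ftr, mul_inv]
      field_simp
    rw [heq, norm_mul]
    calc _ ≤ δ / (1 + α / 2) * ((1 + α / 2) * z.im) :=
          mul_le_mul hball.le (norm_le_of_abs_re_le hz hre.le) (norm_nonneg _) (by positivity)
      _ = δ * z.im := by field_simp
  have h1 := abs_le.1 ((Complex.abs_re_le_norm _).trans hclose)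
  have h2 := abs_le.1 ((Complex.abs_im_le_norm _).trans hclose)
  simp only [Complex.sub_re, Complex.sub_im] at h1 h2
  have hre' := abs_lt.1 hre
  have hmul : δ * z.im + α * (δ * z.im) = α / 4 * z.im := by
    rw [← hδα]
    ring
  have hαim : α * (z.im - δ * z.im) ≤ α * (Ftr s z).im :=
    mul_le_mul_of_nonneg_left (by linarith) hα.le
  have hαz : 0 < α * z.im := by positivity
  refine ⟨abs_lt.2 ⟨by nlinarith, by nlinarith⟩, ?_⟩
  have hδz : δ * z.im ≤ z.im / 4 := by
    have : δ ≤ 1 / 4 := by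
      rw [hδ, div_le_iff₀ (by positivity)]
      linarith
    nlinarith
  linarith

lemma tcone_subset_tcone {α β M N : ℝ} (hM : 0 ≤ M) (h : β ≤ α) (h' : M ≤ N) :
    tcone β N ⊆ tcone α M := by
  rintro z ⟨hre, him⟩
  refine ⟨hre.trans_le (mul_le_mul_of_nonneg_right h ?_), h'.trans_lt him⟩
  linarith

/-- If `φ + φρ` is a Voiculescu transform of `c` and `s` subordinates `c` to `ρ`, then
`φ ∘ F_ρ` is a Voiculescu transform of `s`. -/
lemma isVT_comp_Ftr {ρ c s : Measure ℝ} [IsProbabilityMeasure s] {φ φρ : ℂ → ℂ}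
    (hρ : IsVT ρ φρ) (hc : IsVT c (fun z => φ z + φρ z))
    (hs : ∀ z ∈ UHP, cauchyG c z = cauchyG ρ (Ftr s z)) :
    IsVT s (fun z => φ (Ftr ρ z)) := by
  obtain ⟨α, M, hα, hM, hρ⟩ := hρ
  obtain ⟨α', M', hα', hM', hc⟩ := hc
  obtain ⟨β, N, hβ, hN, hmaps⟩ := exists_tcone_mapsTo s hα hM
  refine ⟨min β α', max N M', lt_min hβ hα', lt_max_of_lt_left hN, fun z hz => ?_⟩
  have hsub : Ftr c z = Ftr ρ (Ftr s z) :=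
    congrArg (·⁻¹) (hs z ((lt_max_of_lt_left hN).trans hz.2))
  have e1 := hρ _ (hmaps (tcone_subset_tcone hN.le (min_le_left _ _) (le_max_left _ _) hz))
  have e2 := hc z (tcone_subset_tcone hM'.le (min_le_right _ _) (le_max_right _ _) hz)
  rw [hsub] at e2
  linear_combination e2 - e1

/-- `(μ ⊞ ν) ⊳ ρ = (μ ⊳ ρ) ⊞ (ν ⊳ ρ)`. Here `c3 = μ ⊞ ν ⊞ ρ`,
`cμρ = μ ⊞ ρ`, `cνρ = ν ⊞ ρ`, and `s1 = (μ ⊞ ν) ⊳ ρ`, `s2 = μ ⊳ ρ`, `s3 = ν ⊳ ρ` are the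
corresponding subordination distributions. -/
theorem stmt11
    (μ ν ρ : Measure ℝ)
    (hμ : IsProbabilityMeasure μ) (hν : IsProbabilityMeasure ν) (hρ : IsProbabilityMeasure ρ)
    (φμ φν φρ : ℂ → ℂ) (hφμ : IsVT μ φμ) (hφν : IsVT ν φν) (hφρ : IsVT ρ φρ)
    (c3 cμρ cνρ : Measure ℝ)
    (hc3prob : IsProbabilityMeasure c3) (hcμρprob : IsProbabilityMeasure cμρ)
    (hcνρprob : IsProbabilityMeasure cνρ)
    (hc3 : IsVT c3 (fun z => φμ z + φν z + φρ z))
    (hcμρ : IsVT cμρ (fun z => φμ z + φρ z))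
    (hcνρ : IsVT cνρ (fun z => φν z + φρ z))
    (s1 s2 s3 : Measure ℝ)
    (hs1prob : IsProbabilityMeasure s1) (hs2prob : IsProbabilityMeasure s2)
    (hs3prob : IsProbabilityMeasure s3)
    (hs1 : ∀ z ∈ UHP, cauchyG c3 z = cauchyG ρ (Ftr s1 z))
    (hs2 : ∀ z ∈ UHP, cauchyG cμρ z = cauchyG ρ (Ftr s2 z))
    (hs3 : ∀ z ∈ UHP, cauchyG cνρ z = cauchyG ρ (Ftr s3 z)) :
    ∃ φ2 φ3 : ℂ → ℂ, IsVT s2 φ2 ∧ IsVT s3 φ3 ∧ IsVT s1 (fun z => φ2 z + φ3 z) := by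
  exact ⟨fun z => φμ (Ftr ρ z), fun z => φν (Ftr ρ z), isVT_comp_Ftr hφρ hcμρ hs2,
    isVT_comp_Ftr hφρ hcνρ hs3,
    isVT_comp_Ftr (φ := fun z => φμ z + φν z) hφρ hc3 hs1⟩
end
end

section
/- Let b, β, β′ ∈ ℝ and γ, γ′ > 0 with c + γ ≥ 0. Then the monotone convolution of free Meixner distributions satisfies μ_{b,c,β,γ} ▷ μ_{b+β, c+γ, β′, γ′} = μ_{b, c, β+β′, γ+γ′}. In particular, for the normalized free Meixner distributions μ_{b,c} = μ_{b,c,0,1} with c ≥ −1, one has μ_{b,c} ▷ μ_{b,c+1} = μ_{b,c}^{⊞2} = μ_{b,c,0,2}. -/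
open MeasureTheory Complex

noncomputable section

/-- `μ` is the free Meixner distribution `μ_{b,c,β,γ}`: its Cauchy transform satisfies the
periodic continued fraction `G_μ(z) = 1/(z − β − γ·w(z))`, where `w = G_{σ_{b+β,c+γ}}` is the
Cauchy transform corresponding to the constant Jacobi parameter tail `(b+β; c+γ)`. -/
def IsFreeMeixner (b c β γ : ℝ) (μ : Measure ℝ) : Prop :=
  IsProbabilityMeasure μ ∧
  ∀ z ∈ UHP, cauchyG μ z =
    (z - (β : ℂ) - (γ : ℂ) * cauchyG (semicircle (b + β) (c + γ)) z)⁻¹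

theorem integral_sin_sq_mul_inv (u : ℂ) (hu0 : u ≠ 0) (hu : ‖u‖ < 1) :
    ∫ θ in (0 : ℝ)..Real.pi,
      ((Real.sin θ : ℝ) : ℂ) ^ 2 * (u + u⁻¹ - 2 * ((Real.cos θ : ℝ) : ℂ))⁻¹ = Real.pi / 2 * u := by
  have hne : ∀ ζ : ℂ, ‖ζ‖ ≤ 1 → 1 - u * ζ ≠ 0 := by
    intro ζ hζ h
    have h1 : u * ζ = 1 := (sub_eq_zero.mp h).symm
    have h2 : ‖u‖ * ‖ζ‖ = 1 := by rw [← norm_mul, h1, norm_one]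
    nlinarith [norm_nonneg u, norm_nonneg ζ]
  set f : ℂ → ℂ := fun ζ => (1 - ζ ^ 2) / (1 - u * ζ) with hf
  have hmean : Real.circleAverage f 0 1 = f 0 := by
    apply DiffContOnCl.circleAverage
    rw [abs_one]
    apply DifferentiableOn.diffContOnCl
    intro ζ hζ
    have hζ' : ‖ζ‖ ≤ 1 := by
      rw [closure_ball _ one_ne_zero] at hζ
      simpa using hζ
    apply DifferentiableAt.differentiableWithinAt
    exact DifferentiableAt.div (by fun_prop) (by fun_prop) (hne ζ hζ')
  have hnorm : ∀ θ : ℝ, ‖circleMap 0 1 θ‖ = 1 := by simp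
  have hcont : Continuous fun θ : ℝ => f (circleMap 0 1 θ) := by
    apply Continuous.div (by fun_prop) (by fun_prop)
    exact fun θ => hne _ (hnorm θ).le
  have hfull : ∫ θ in (-Real.pi)..Real.pi, f (circleMap 0 1 θ) = 2 * Real.pi := by
    have hper : Function.Periodic (fun θ : ℝ => f (circleMap 0 1 θ)) (2 * Real.pi) :=
      fun θ => by simp only [periodic_circleMap 0 1 θ]
    have h := hper.intervalIntegral_add_eq (-Real.pi) 0
    rw [show -Real.pi + 2 * Real.pi = Real.pi by ring, zero_add] at h
    rw [h]
    rw [Real.circleAverage_def] at hmean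
    have hpi : ((2 * Real.pi : ℝ) : ℂ) ≠ 0 := by exact_mod_cast Real.two_pi_pos.ne'
    rw [Complex.real_smul, Complex.ofReal_inv, inv_mul_eq_iff_eq_mul₀ hpi] at hmean
    rw [hmean]
    simp [hf]
  have hfold : ∫ θ in (-Real.pi)..Real.pi, f (circleMap 0 1 θ) =
      ∫ θ in (0 : ℝ)..Real.pi, (f (circleMap 0 1 (-θ)) + f (circleMap 0 1 θ)) := by
    have hneg := intervalIntegral.integral_comp_neg (a := 0) (b := Real.pi)
      (fun θ : ℝ => f (circleMap 0 1 θ))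
    rw [neg_zero] at hneg
    rw [intervalIntegral.integral_add
      (f := fun θ => f (circleMap 0 1 (-θ)))
      ((hcont.comp continuous_neg).intervalIntegrable _ _) (hcont.intervalIntegrable _ _), hneg,
      intervalIntegral.integral_add_adjacent_intervals (hcont.intervalIntegrable _ _)
      (hcont.intervalIntegrable _ _)]
  have hpt : ∀ θ : ℝ, f (circleMap 0 1 (-θ)) + f (circleMap 0 1 θ) = 4 * u⁻¹ *
      (((Real.sin θ : ℝ) : ℂ) ^ 2 * (u + u⁻¹ - 2 * ((Real.cos θ : ℝ) : ℂ))⁻¹) := by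
    intro θ
    have hp := hne _ (hnorm θ).le
    have hm := hne _ (hnorm (-θ)).le
    have hep : circleMap 0 1 θ = Real.cos θ + Real.sin θ * I := by
      simp [circleMap, Complex.exp_mul_I]
    have hem : circleMap 0 1 (-θ) = Real.cos θ - Real.sin θ * I := by
      rw [circleMap, Complex.exp_mul_I, ← ofReal_cos, ← ofReal_sin, Real.cos_neg, Real.sin_neg]
      push_cast
      ring
    have hcs : ((Real.sin θ : ℝ) : ℂ) ^ 2 + ((Real.cos θ : ℝ) : ℂ) ^ 2 = 1 := by
      exact_mod_cast Real.sin_sq_add_cos_sq θ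
    rw [hep] at hp
    rw [hem] at hm
    simp only [hf, hep, hem]
    generalize ((Real.sin θ : ℝ) : ℂ) = s at *
    generalize ((Real.cos θ : ℝ) : ℂ) = c at *
    have hprod : (1 - u * (c - s * I)) * (1 - u * (c + s * I)) = u * (u + u⁻¹ - 2 * c) := by
      field_simp
      linear_combination u ^ 2 * hcs - u ^ 2 * s ^ 2 * I_sq
    have hden : u + u⁻¹ - 2 * c ≠ 0 := by
      intro h
      rw [h, mul_zero] at hprod
      exact (mul_ne_zero hm hp) hprod
    rw [div_add_div _ _ hm hp, hprod, div_eq_iff (mul_ne_zero hu0 hden)]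
    have : 4 * u⁻¹ * (s ^ 2 * (u + u⁻¹ - 2 * c)⁻¹) * (u * (u + u⁻¹ - 2 * c)) = 4 * s ^ 2 := by
      rw [show 4 * u⁻¹ * (s ^ 2 * (u + u⁻¹ - 2 * c)⁻¹) * (u * (u + u⁻¹ - 2 * c)) =
        4 * s ^ 2 * (u⁻¹ * u) * ((u + u⁻¹ - 2 * c)⁻¹ * (u + u⁻¹ - 2 * c)) by ring,
        inv_mul_cancel₀ hu0, inv_mul_cancel₀ hden]
      ring
    rw [this]
    have hpq : (c - s * I) * (c + s * I) = 1 := by linear_combination hcs - s ^ 2 * I_sq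
    linear_combination (2 * c * u - 2) * hpq - 4 * s ^ 2 * I_sq
  rw [hfull] at hfold
  simp_rw [hpt] at hfold
  rw [intervalIntegral.integral_const_mul] at hfold
  field_simp at hfold ⊢
  linear_combination -hfold / 2

/-- Every `t` off the real line is `u + u⁻¹` with `u` in the punctured unit disc; this is the
inverse of the Joukowski map. -/
theorem exists_add_inv_eq (t : ℂ) (ht : t.im ≠ 0) :
    ∃ u : ℂ, u ≠ 0 ∧ ‖u‖ < 1 ∧ u + u⁻¹ = t := by
  obtain ⟨d, hd⟩ := IsAlgClosed.exists_pow_nat_eq (t ^ 2 - 4) two_pos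
  set v : ℂ := (t + d) / 2 with hv
  have hq : v * (t - v) = 1 := by
    rw [hv]
    linear_combination -hd / 4
  have hv0 : v ≠ 0 := left_ne_zero_of_mul_eq_one hq
  have hsum : v + v⁻¹ = t := by
    rw [inv_eq_of_mul_eq_one_right hq]
    ring
  rcases lt_trichotomy ‖v‖ 1 with h | h | h
  · exact ⟨v, hv0, h, hsum⟩
  · refine absurd ?_ ht
    rw [← hsum, Complex.inv_eq_conj h]
    simp
  · exact ⟨v⁻¹, inv_ne_zero hv0, by rw [norm_inv]; exact inv_lt_one_of_one_lt₀ h,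
      by rw [inv_inv, add_comm, hsum]⟩

theorem im_neg_of_im_add_inv_pos (u : ℂ) (hu0 : u ≠ 0) (hu : ‖u‖ < 1) (h : 0 < (u + u⁻¹).im) :
    u.im < 0 := by
  have hn : 0 < normSq u := normSq_pos.mpr hu0
  have hn1 : normSq u < 1 := by
    rw [normSq_eq_norm_sq]
    nlinarith [norm_nonneg u]
  rw [add_im, inv_im] at h
  by_contra! hi
  have : u.im ≤ u.im / normSq u := by
    rw [le_div_iff₀ hn]
    nlinarith
  rw [neg_div] at h
  linarith

theorem cauchyG_semicircle_eq_intervalIntegral (a r : ℝ) (hr : 0 < r) (z : ℂ) :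
    cauchyG (semicircle a (r ^ 2)) z = ∫ x in (a - 2 * r)..(a + 2 * r),
      (((2 * Real.pi * r ^ 2)⁻¹ * Real.sqrt (4 * r ^ 2 - (x - a) ^ 2) : ℝ) : ℂ) *
        (z - (x : ℂ))⁻¹ := by
  have hzero : ∀ x : ℝ, x ∉ Set.Ioc (a - 2 * r) (a + 2 * r) →
      (((2 * Real.pi * r ^ 2)⁻¹ * Real.sqrt (4 * r ^ 2 - (x - a) ^ 2) : ℝ) : ℂ) *
        (z - (x : ℂ))⁻¹ = 0 := by
    intro x hx
    have : 4 * r ^ 2 - (x - a) ^ 2 ≤ 0 := by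
      rw [Set.mem_Ioc, not_and_or, not_lt, not_le] at hx
      rcases hx with hx | hx <;> nlinarith
    rw [Real.sqrt_eq_zero_of_nonpos this]
    simp
  rw [intervalIntegral.integral_of_le (by linarith),
    setIntegral_eq_integral_of_forall_compl_eq_zero hzero, cauchyG, semicircle,
    if_neg (by positivity), integral_withDensity_eq_integral_toReal_smul (by fun_prop) (by simp)]
  refine integral_congr_ae (Filter.Eventually.of_forall fun x => ?_)
  simp only
  rw [ENNReal.toReal_ofReal (by positivity), Complex.real_smul]

theorem cauchyG_semicircle_eq_div (a r : ℝ) (hr : 0 < r) (z u : ℂ) (hz : z ∈ UHP)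
    (hu0 : u ≠ 0) (hu : ‖u‖ < 1) (hzu : z = a + r * (u + u⁻¹)) :
    cauchyG (semicircle a (r ^ 2)) z = u / r := by
  have hrC : (r : ℂ) ≠ 0 := by exact_mod_cast hr.ne'
  have hpi : (Real.pi : ℂ) ≠ 0 := by exact_mod_cast Real.pi_ne_zero
  rw [cauchyG_semicircle_eq_intervalIntegral a r hr z]
  set g : ℝ → ℂ := fun x =>
    (((2 * Real.pi * r ^ 2)⁻¹ * Real.sqrt (4 * r ^ 2 - (x - a) ^ 2) : ℝ) : ℂ) *
        (z - (x : ℂ))⁻¹ with hg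
  have hzx : ∀ x : ℝ, z - (x : ℂ) ≠ 0 := by
    intro x h
    have him : (z - (x : ℂ)).im = 0 := by rw [h]; simp
    simp only [sub_im, ofReal_im, sub_zero] at him
    exact (ne_of_gt hz) him
  have hgc : Continuous g :=
    Continuous.mul (by fun_prop) (Continuous.inv₀ (by fun_prop) hzx)
  have hderiv : ∀ θ : ℝ,
      HasDerivAt (fun θ => a + 2 * r * Real.cos θ) (-(2 * r * Real.sin θ)) θ := by
    intro θ
    simpa using ((Real.hasDerivAt_cos θ).const_mul (2 * r)).const_add a
  have hsub := intervalIntegral.integral_deriv_smul_comp (a := 0) (b := Real.pi)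
    (g := g) (fun θ _ => hderiv θ) (by fun_prop) hgc
  have hpt : ∀ θ ∈ Set.uIcc 0 Real.pi,
      (-(2 * r * Real.sin θ)) • (g ∘ fun θ => a + 2 * r * Real.cos θ) θ =
        -(2 / (Real.pi * r)) * (((Real.sin θ : ℝ) : ℂ) ^ 2 *
          (u + u⁻¹ - 2 * ((Real.cos θ : ℝ) : ℂ))⁻¹) := by
    intro θ hθ
    rw [Set.uIcc_of_le Real.pi_pos.le] at hθ
    have hsin : 0 ≤ Real.sin θ := Real.sin_nonneg_of_mem_Icc hθ
    have hsqrt : Real.sqrt (4 * r ^ 2 - (a + 2 * r * Real.cos θ - a) ^ 2) =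
        2 * r * Real.sin θ := by
      rw [show 4 * r ^ 2 - (a + 2 * r * Real.cos θ - a) ^ 2 = (2 * r * Real.sin θ) ^ 2 by
        linear_combination (-4 * r ^ 2) * Real.sin_sq_add_cos_sq θ]
      exact Real.sqrt_sq (by positivity)
    have hden : z - ((a + 2 * r * Real.cos θ : ℝ) : ℂ) =
        r * (u + u⁻¹ - 2 * ((Real.cos θ : ℝ) : ℂ)) := by
      rw [hzu]
      push_cast
      ring
    simp only [hg, Function.comp_apply, hsqrt, hden, Complex.real_smul, mul_inv]
    generalize (u + u⁻¹ - 2 * ((Real.cos θ : ℝ) : ℂ))⁻¹ = k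
    push_cast
    field_simp
  rw [intervalIntegral.integral_congr hpt, intervalIntegral.integral_const_mul,
    integral_sin_sq_mul_inv u hu0 hu, Real.cos_zero, Real.cos_pi,
    intervalIntegral.integral_symm, show a + 2 * r * -1 = a - 2 * r by ring, mul_one] at hsub
  rw [← neg_inj, ← hsub]
  field_simp

/-- The Cauchy transform of a semicircular distribution is the root with negative imaginary part
of its quadratic equation. -/
theorem cauchyG_semicircle_spec (a s : ℝ) (hs : 0 ≤ s) (z : ℂ) (hz : z ∈ UHP) :
    s * cauchyG (semicircle a s) z ^ 2 - (z - a) * cauchyG (semicircle a s) z + 1 = 0 ∧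
      (cauchyG (semicircle a s) z).im < 0 := by
  have hz' : 0 < z.im := hz
  rcases hs.eq_or_lt with rfl | hs
  · have hza : z - (a : ℂ) ≠ 0 := by
      intro h
      have him : (z - (a : ℂ)).im = 0 := by rw [h]; simp
      simp only [sub_im, ofReal_im, sub_zero] at him
      exact hz'.ne' him
    rw [cauchyG, semicircle, if_pos rfl, integral_dirac]
    refine ⟨by simp [hza], ?_⟩
    rw [inv_im]
    refine div_neg_of_neg_of_pos ?_ (normSq_pos.mpr hza)
    simpa using hz'
  · obtain ⟨r, hr, rfl⟩ : ∃ r : ℝ, 0 < r ∧ s = r ^ 2 :=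
      ⟨Real.sqrt s, Real.sqrt_pos.mpr hs, (Real.sq_sqrt hs.le).symm⟩
    have hrC : (r : ℂ) ≠ 0 := by exact_mod_cast hr.ne'
    have htim : 0 < ((z - a) / (r : ℂ)).im := by
      rw [div_ofReal_im]
      simpa using div_pos hz' hr
    obtain ⟨u, hu0, hu, hut⟩ := exists_add_inv_eq _ htim.ne'
    have hzu : z = a + r * (u + u⁻¹) := by
      rw [hut]
      field_simp
      ring
    rw [cauchyG_semicircle_eq_div a r hr z u hz hu0 hu hzu]
    constructor
    · rw [hzu]
      push_cast
      field_simp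
      ring
    · rw [div_ofReal_im]
      exact div_neg_of_neg_of_pos (im_neg_of_im_add_inv_pos u hu0 hu (hut ▸ htim)) hr

theorem eq_of_quadratic_of_im_neg (s : ℝ) (hs : 0 ≤ s) (w u v : ℂ) (hw : 0 < w.im)
    (hu : s * u ^ 2 - w * u + 1 = 0) (hv : s * v ^ 2 - w * v + 1 = 0)
    (hui : u.im < 0) (hvi : v.im < 0) : u = v := by
  have hmul : (u - v) * (s * (u + v) - w) = 0 := by linear_combination hu - hv
  rcases mul_eq_zero.mp hmul with h | h
  · exact sub_eq_zero.mp h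
  · have him := congrArg im h
    simp only [sub_im, im_ofReal_mul, add_im, zero_im] at him
    nlinarith

/-- Subordination of semicircular Cauchy transforms. -/
theorem cauchyG_semicircle_comp (a β s γ : ℝ) (hs : 0 ≤ s) (hγ : 0 ≤ γ) (z : ℂ) (hz : z ∈ UHP) :
    z - β - γ * cauchyG (semicircle (a + β) (s + γ)) z ∈ UHP ∧
    cauchyG (semicircle a s) (z - β - γ * cauchyG (semicircle (a + β) (s + γ)) z) =
      cauchyG (semicircle (a + β) (s + γ)) z := by
  obtain ⟨hq, hi⟩ := cauchyG_semicircle_spec (a + β) (s + γ) (add_nonneg hs hγ) z hz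
  set g := cauchyG (semicircle (a + β) (s + γ)) z
  have hz' : 0 < z.im := hz
  have hw : 0 < (z - β - γ * g).im := by
    simp only [sub_im, ofReal_im, im_ofReal_mul]
    nlinarith
  obtain ⟨hq', hi'⟩ := cauchyG_semicircle_spec a s hs _ hw
  refine ⟨hw, eq_of_quadratic_of_im_neg s hs (z - β - γ * g - a) _ _ ?_ hq' ?_ hi' hi⟩
  · simpa using hw
  · push_cast at hq
    linear_combination hq

/-- Monotone convolution identity for free Meixner distributions:
`μ_{b,c,β,γ} ▷ μ_{b+β,c+γ,β′,γ′} = μ_{b,c,β+β′,γ+γ′}`, where the monotone convolution `mc`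
is defined by `F_{mc} = F_{m2} ∘ F_{m3}`. In particular (the case `β = β′ = 0`,
`γ = γ′ = 1`, `c ≥ −1`): `μ_{b,c} ▷ μ_{b,c+1} = μ_{b,c}^{⊞2} = μ_{b,c,0,2}`. -/
theorem stmt14
    (b c β β' γ γ' : ℝ) (hγ : 0 < γ) (hγ' : 0 < γ') (hc : 0 ≤ c + γ)
    (m2 m3 : Measure ℝ)
    (h2 : IsFreeMeixner b c β γ m2) (h3 : IsFreeMeixner (b + β) (c + γ) β' γ' m3)
    (mc : Measure ℝ) (hmcprob : IsProbabilityMeasure mc)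
    (hmc : ∀ z ∈ UHP, Ftr mc z = Ftr m2 (Ftr m3 z)) :
    IsFreeMeixner b c (β + β') (γ + γ') mc ∧
    (β = 0 → β' = 0 → γ = 1 → γ' = 1 → IsFreeMeixner b c 0 2 mc) := by
  have main : IsFreeMeixner b c (β + β') (γ + γ') mc := by
    refine ⟨hmcprob, fun z hz => ?_⟩
    obtain ⟨hw, hcomp⟩ := cauchyG_semicircle_comp (b + β) β' (c + γ) γ' hc hγ'.le z hz
    have hmc' : cauchyG mc z = cauchyG m2 (Ftr m3 z) := inv_injective (hmc z hz)
    rw [hmc', Ftr, h3.2 z hz, inv_inv, h2.2 _ hw, hcomp, ← add_assoc b, ← add_assoc c]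
    push_cast
    ring
  refine ⟨main, ?_⟩
  rintro rfl rfl rfl rfl
  convert main using 1 <;> norm_num
end
end

section
/- Let μ, ν be unital linear functionals on ℂ⟨x₁,…,x_d⟩ and μ ⊳ ν their subordination distribution. Then the moment generating functions satisfy, as formal power series in noncommuting indeterminates z₁,…,z_d: 1 + M^{μ⊞ν}(z) = (1 + M^{μ⊳ν}(z)) · (1 + M^ν(z₁(1 + M^{μ⊳ν}(z)), …, z_d(1 + M^{μ⊳ν}(z)))). Consequently, for fixed ν, the map μ ↦ μ ⊳ ν is a bijection of D_alg(d) onto itself. -/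
open scoped BigOperators

noncomputable section

/-- Formal noncommutative power series in `d` indeterminates: coefficient functions on words.
A unital linear functional `μ` on `ℂ⟨x₁,…,x_d⟩` is identified with the coefficient function
`w ↦ μ[x_w]` of the series `1 + M^μ`; being unital means the coefficient of the empty word
is `1`. -/
abbrev NCS (d : ℕ) := List (Fin d) → ℂ

/-- The constant series `1`. -/
def oneS (d : ℕ) : NCS d := fun w => if w = [] then 1 else 0

/-- Product of noncommutative formal power series: convolution over splittings of words. -/
def mulS {d : ℕ} (f g : NCS d) : NCS d :=
  fun w => ∑ j ∈ Finset.range (w.length + 1), f (List.take j w) * g (List.drop j w)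

/-- The substitution `R(z₁·A, …, z_d·A)`: each monomial `z_{u(1)} ⋯ z_{u(k)}` of `R`
is replaced by `z_{u(1)} A z_{u(2)} A ⋯ z_{u(k)} A`. -/
def substS {d : ℕ} (R A : NCS d) : List (Fin d) → ℂ
  | [] => R []
  | i :: w => ∑ j ∈ Finset.range (w.length + 1),
      A (List.take j w) * substS (fun u => R (i :: u)) A (List.drop j w)
  termination_by w => w.length
  decreasing_by
    simp only [List.length_drop, List.length_cons]
    omega

/-- `R` is the `R`-transform of the functional with moment series `m = 1 + M`:
`R(z₁(1+M),…,z_d(1+M)) = M`, i.e. `substS R m = m - 1`. -/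
def HasR {d : ℕ} (m R : NCS d) : Prop :=
  R [] = 0 ∧ ∀ w, substS R m w = m w - oneS d w

/-- `m3` is the moment series of the free convolution of the functionals with moment series
`m1, m2`: `R`-transforms add. -/
def IsFreeConvS {d : ℕ} (m1 m2 m3 : NCS d) : Prop :=
  ∃ R1 R2 : NCS d, HasR m1 R1 ∧ HasR m2 R2 ∧ HasR m3 (fun w => R1 w + R2 w)

/-- `ms` is the moment series of the subordination distribution `μ1 ⊳ μ2`:
`R^{μ1⊳μ2}(z) = R^{μ1}(z₁(1+M^{μ2}),…)·(1+M^{μ2})⁻¹`, i.e.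
`R^{μ1⊳μ2}·(1+M^{μ2}) = R^{μ1}(z(1+M^{μ2}))`. -/
def IsSubordS {d : ℕ} (m1 m2 ms : NCS d) : Prop :=
  ∃ R1 Rs : NCS d, HasR m1 R1 ∧ HasR ms Rs ∧ ∀ w, mulS Rs m2 w = substS R1 m2 w

/-- The left derivative of a series: the coefficients of the words starting with `i`. -/
def derivS {d : ℕ} (i : Fin d) (f : NCS d) : NCS d := fun u => f (i :: u)

section Product

variable {d : ℕ}

lemma mulS_nil (f g : NCS d) : mulS f g [] = f [] * g [] := by
  simp [mulS]

lemma mulS_cons (f g : NCS d) (i : Fin d) (w : List (Fin d)) :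
    mulS f g (i :: w) = f [] * g (i :: w) + mulS (derivS i f) g w := by
  simp only [mulS, List.length_cons, derivS]
  rw [Finset.sum_range_succ', add_comm]
  simp

lemma derivS_mulS (f g : NCS d) (i : Fin d) :
    derivS i (mulS f g) = f [] • derivS i g + mulS (derivS i f) g := by
  funext w
  simp [derivS, mulS_cons]

lemma mulS_congr {f f' g g' : NCS d} {w : List (Fin d)}
    (hf : ∀ v, v.length ≤ w.length → f v = f' v)
    (hg : ∀ v, v.length ≤ w.length → g v = g' v) : mulS f g w = mulS f' g' w := by
  refine Finset.sum_congr rfl fun j _ => ?_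
  rw [hf _ (by simp), hg _ (by simp)]

lemma mulS_add_left (f f' g : NCS d) : mulS (f + f') g = mulS f g + mulS f' g := by
  funext w
  simp [mulS, add_mul, Finset.sum_add_distrib]

lemma mulS_sub_left (f f' g : NCS d) : mulS (f - f') g = mulS f g - mulS f' g := by
  funext w
  simp [mulS, sub_mul, Finset.sum_sub_distrib]

lemma mulS_add_right (f g g' : NCS d) : mulS f (g + g') = mulS f g + mulS f g' := by
  funext w
  simp [mulS, mul_add, Finset.sum_add_distrib]

lemma mulS_smul_left (c : ℂ) (f g : NCS d) : mulS (c • f) g = c • mulS f g := by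
  funext w
  simp [mulS, Finset.mul_sum, mul_assoc]

lemma mulS_smul_right (c : ℂ) (f g : NCS d) : mulS f (c • g) = c • mulS f g := by
  funext w
  simp [mulS, Finset.mul_sum, mul_left_comm]

lemma zero_mulS (g : NCS d) : mulS 0 g = 0 := by
  funext w
  simp [mulS]

lemma derivS_oneS (i : Fin d) : derivS i (oneS d) = 0 := by
  funext w
  simp [derivS, oneS]

lemma oneS_mulS (g : NCS d) : mulS (oneS d) g = g := by
  funext w
  cases w with
  | nil => simp [mulS_nil, oneS]
  | cons i w => simp [mulS_cons, derivS_oneS, zero_mulS, oneS]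

lemma mulS_assoc (f g h : NCS d) : mulS (mulS f g) h = mulS f (mulS g h) := by
  funext w
  induction w generalizing f g h with
  | nil => simp [mulS_nil, mul_assoc]
  | cons i w ih =>
    rw [mulS_cons, derivS_mulS, mulS_add_left, mulS_smul_left, mulS_cons f, mulS_cons g,
      mulS_nil, Pi.add_apply, ih, Pi.smul_apply, smul_eq_mul]
    ring

end Product

section FixedPoint

variable {d : ℕ}

/-- An operator on series is contracting if the coefficient of a word in the image depends only
on the coefficients of strictly shorter words. -/
def ContractingS (F : NCS d → NCS d) : Prop :=
  ∀ f g w, (∀ v : List (Fin d), v.length < w.length → f v = g v) → F f w = F g w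

/-- The fixed point of a contracting operator on series. -/
def fixS (F : NCS d → NCS d) (w : List (Fin d)) : ℂ :=
  F (fun v => if _h : v.length < w.length then fixS F v else 0) w
  termination_by w.length

lemma ContractingS.fixS_eq {F : NCS d → NCS d} (hF : ContractingS F) : F (fixS F) = fixS F := by
  funext w
  rw [fixS]
  refine hF _ _ _ fun v hv => ?_
  simp [hv]

lemma ContractingS.unique {F : NCS d → NCS d} (hF : ContractingS F) {f g : NCS d}
    (hf : F f = f) (hg : F g = g) : f = g := by
  have key : ∀ n, ∀ w : List (Fin d), w.length < n → f w = g w := by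
    intro n
    induction n with
    | zero => intro w hw; omega
    | succ n ih =>
      intro w hw
      rw [← hf, ← hg]
      exact hF _ _ _ fun v hv => ih v (by omega)
  funext w
  exact key _ w (Nat.lt_succ_self _)

end FixedPoint

section Inverse

variable {d : ℕ}

lemma exists_right_inverse_mulS (f : NCS d) (hf : f [] = 1) :
    ∃ g : NCS d, g [] = 1 ∧ mulS f g = oneS d := by
  let F : NCS d → NCS d := fun g w =>
    match w with
    | [] => 1
    | i :: u => -mulS (derivS i f) g u
  have hF : ContractingS F := by
    intro g g' w h
    cases w with
    | nil => rfl
    | cons i u =>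
      refine congrArg Neg.neg (mulS_congr (fun _ _ => rfl) fun v hv => h v ?_)
      simpa using Nat.lt_succ_of_le hv
  have hfix := hF.fixS_eq
  refine ⟨fixS F, (congrFun hfix []).symm, ?_⟩
  funext w
  cases w with
  | nil =>
    have h : fixS F [] = 1 := (congrFun hfix []).symm
    simp [mulS_nil, hf, h, oneS]
  | cons i u =>
    have h : fixS F (i :: u) = -mulS (derivS i f) (fixS F) u := (congrFun hfix (i :: u)).symm
    simp [mulS_cons, hf, h, oneS]

lemma mulS_oneS (f : NCS d) : mulS f (oneS d) = f := by
  funext w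
  induction w generalizing f with
  | nil => simp [mulS_nil, oneS]
  | cons i w ih => simp [mulS_cons, ih, oneS, derivS]

lemma exists_inverse_mulS (f : NCS d) (hf : f [] = 1) :
    ∃ g : NCS d, mulS f g = oneS d ∧ mulS g f = oneS d := by
  obtain ⟨g, hg, hfg⟩ := exists_right_inverse_mulS f hf
  obtain ⟨h, -, hgh⟩ := exists_right_inverse_mulS g hg
  have hfh : f = h := by
    rw [← mulS_oneS f, ← hgh, ← mulS_assoc, hfg, oneS_mulS]
  exact ⟨g, hfg, hfh ▸ hgh⟩

end Inverse

section Substitution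

variable {d : ℕ}

lemma substS_nil (R A : NCS d) : substS R A [] = R [] := by
  rw [substS]

lemma substS_cons (R A : NCS d) (i : Fin d) (w : List (Fin d)) :
    substS R A (i :: w) = mulS A (substS (derivS i R) A) w := by
  rw [substS]
  rfl

lemma derivS_substS (R A : NCS d) (i : Fin d) :
    derivS i (substS R A) = mulS A (substS (derivS i R) A) :=
  funext fun w => substS_cons R A i w

/-- Induction on the length of words. -/
lemma word_length_induction {P : List (Fin d) → Prop} (hnil : P [])
    (hcons : ∀ i w, (∀ v : List (Fin d), v.length ≤ w.length → P v) → P (i :: w))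
    (w : List (Fin d)) : P w := by
  have key : ∀ n, ∀ w : List (Fin d), w.length < n → P w := by
    intro n
    induction n with
    | zero => intro w hw; omega
    | succ n ih =>
      intro w hw
      cases w with
      | nil => exact hnil
      | cons i w =>
        exact hcons i w fun v hv => ih v (by rw [List.length_cons] at hw; omega)
  exact key _ w (Nat.lt_succ_self _)

lemma substS_congr (w : List (Fin d)) : ∀ {R A B : NCS d},
    (∀ v : List (Fin d), v.length < w.length → A v = B v) → substS R A w = substS R B w := by
  induction w using word_length_induction with
  | hnil => intro R A B _; simp [substS_nil]
  | hcons i w ih =>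
    intro R A B h
    rw [substS_cons, substS_cons]
    refine mulS_congr (fun v hv => h v (by simp; omega)) fun v hv => ih v hv fun u hu => h u ?_
    rw [List.length_cons]
    omega

lemma substS_add (R S A : NCS d) : substS (R + S) A = substS R A + substS S A := by
  funext w
  induction w using word_length_induction generalizing R S with
  | hnil => simp [substS_nil]
  | hcons i w ih =>
    rw [Pi.add_apply, substS_cons, substS_cons, substS_cons, ← Pi.add_apply, ← mulS_add_right]
    exact mulS_congr (fun _ _ => rfl) fun v hv => ih v hv _ _

lemma substS_smul (c : ℂ) (R A : NCS d) : substS (c • R) A = c • substS R A := by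
  funext w
  induction w using word_length_induction generalizing R with
  | hnil => simp [substS_nil]
  | hcons i w ih =>
    rw [Pi.smul_apply, substS_cons, substS_cons, ← Pi.smul_apply, ← mulS_smul_right]
    exact mulS_congr (fun _ _ => rfl) fun v hv => ih v hv _

lemma substS_sub (R S A : NCS d) : substS (R - S) A = substS R A - substS S A := by
  have h : R - S = R + (-1 : ℂ) • S := by rw [neg_one_smul, sub_eq_add_neg]
  rw [h, substS_add, substS_smul, neg_one_smul, sub_eq_add_neg]

lemma substS_zero (A : NCS d) : substS 0 A = 0 := by
  simpa using substS_smul 0 0 A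

lemma substS_oneS (A : NCS d) : substS (oneS d) A = oneS d := by
  funext w
  cases w with
  | nil => rw [substS_nil]
  | cons i w =>
    rw [substS_cons, derivS_oneS, substS_zero]
    simp [mulS, oneS]

lemma substS_mulS (f g A : NCS d) :
    substS (mulS f g) A = mulS (substS f A) (substS g A) := by
  funext w
  induction w using word_length_induction generalizing f g with
  | hnil => simp [substS_nil, mulS_nil]
  | hcons i w ih =>
    rw [substS_cons, derivS_mulS, substS_add, substS_smul, mulS_add_right, mulS_smul_right,
      mulS_cons, substS_nil, substS_cons, derivS_substS, mulS_assoc]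
    exact congrArg (f [] * mulS A (substS (derivS i g) A) w + ·)
      (mulS_congr (fun _ _ => rfl) fun v hv => ih v hv _ _)

lemma substS_substS (R A B : NCS d) :
    substS (substS R B) A = substS R (mulS A (substS B A)) := by
  funext w
  induction w using word_length_induction generalizing R with
  | hnil => simp [substS_nil]
  | hcons i w ih =>
    rw [substS_cons, derivS_substS, substS_mulS, ← mulS_assoc, substS_cons]
    exact mulS_congr (fun _ _ => rfl) fun v hv => ih v hv _

lemma substS_injective {A : NCS d} (hA : A [] = 1) {R S : NCS d}
    (h : substS R A = substS S A) : R = S := by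
  obtain ⟨B, -, hBA⟩ := exists_inverse_mulS A hA
  funext w
  induction w generalizing R S with
  | nil => rw [← substS_nil R A, h, substS_nil]
  | cons i w ih =>
    refine ih (R := derivS i R) (S := derivS i S) ?_
    have hi := congrArg (fun f => mulS B (derivS i f)) h
    simpa only [derivS_substS, ← mulS_assoc, hBA, oneS_mulS] using hi

/-- The series `R` with `R(z₁A, …, z_dA) = S`, where `B` is the inverse of `A`. -/
def unsubstS (B : NCS d) : NCS d → List (Fin d) → ℂ
  | S, [] => S []
  | S, i :: w => unsubstS B (mulS B (derivS i S)) w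

lemma substS_surjective {A : NCS d} (hA : A [] = 1) (S : NCS d) :
    ∃ R : NCS d, substS R A = S := by
  obtain ⟨B, hAB, -⟩ := exists_inverse_mulS A hA
  refine ⟨unsubstS B S, ?_⟩
  funext w
  induction w using word_length_induction generalizing S with
  | hnil => rw [substS_nil, unsubstS]
  | hcons i w ih =>
    have hd : derivS i (unsubstS B S) = unsubstS B (mulS B (derivS i S)) := by
      funext u
      rw [derivS, unsubstS]
    rw [substS_cons, hd, mulS_congr (fun _ _ => rfl) fun v hv => ih v hv _, ← mulS_assoc, hAB,
      oneS_mulS, derivS]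

end Substitution

section RTransform

variable {d : ℕ}

lemma HasR.substS_eq {m R : NCS d} (h : HasR m R) : substS R m = m - oneS d :=
  funext h.2

lemma HasR.nil_eq_one {m R : NCS d} (h : HasR m R) : m [] = 1 := by
  have h0 := h.2 []
  rw [substS_nil, h.1] at h0
  simpa [oneS] using (sub_eq_zero.mp h0.symm)

lemma contractingS_substS (R : NCS d) : ContractingS fun m => substS R m + oneS d :=
  fun _ _ w h => congrArg (· + oneS d w) (substS_congr w h)

lemma HasR.moments_unique {m m' R : NCS d} (h : HasR m R) (h' : HasR m' R) : m = m' := by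
  refine (contractingS_substS R).unique ?_ ?_
  · rw [h.substS_eq, sub_add_cancel]
  · rw [h'.substS_eq, sub_add_cancel]

lemma HasR.transform_unique {m R R' : NCS d} (h : HasR m R) (h' : HasR m R') : R = R' :=
  substS_injective h.nil_eq_one (h.substS_eq.trans h'.substS_eq.symm)

lemma exists_moments_hasR {R : NCS d} (hR : R [] = 0) : ∃ m, HasR m R := by
  refine ⟨fixS fun m => substS R m + oneS d, hR, fun w => ?_⟩
  exact eq_sub_of_add_eq (congrFun (contractingS_substS R).fixS_eq w)

lemma exists_hasR {m : NCS d} (hm : m [] = 1) : ∃ R, HasR m R := by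
  obtain ⟨R, hR⟩ := substS_surjective hm (m - oneS d)
  refine ⟨R, ?_, congrFun hR⟩
  rw [← substS_nil R m, hR]
  simp [hm, oneS]

end RTransform

section Subordination

variable {d : ℕ}

lemma IsSubordS.freeConv_eq {mμ mν ms mc : NCS d} (hsub : IsSubordS mμ mν ms)
    (hconv : IsFreeConvS mμ mν mc) : mc = mulS ms (substS mν ms) := by
  obtain ⟨R1, Rs, hR1, hRs, hmul⟩ := hsub
  obtain ⟨R1', R2, hR1', hR2, hR3⟩ := hconv
  obtain rfl := hR1.transform_unique hR1'
  refine hR3.moments_unique ⟨hR3.1, congrFun ?_⟩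
  have h1 : substS R1 (mulS ms (substS mν ms)) = mulS ms (substS mν ms) - substS mν ms := by
    rw [← substS_substS, ← funext hmul, substS_mulS, hRs.substS_eq, mulS_sub_left, oneS_mulS]
  have h2 : substS R2 (mulS ms (substS mν ms)) = substS mν ms - oneS d := by
    rw [← substS_substS, hR2.substS_eq, substS_sub, substS_oneS]
  change substS (R1 + R2) _ = mulS ms (substS mν ms) - oneS d
  rw [substS_add, h1, h2, sub_add_sub_cancel]

lemma exists_isSubordS {mν mlam : NCS d} (hν : mν [] = 1) (hlam : mlam [] = 1) :
    ∃ m' : NCS d, m' [] = 1 ∧ IsSubordS m' mν mlam := by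
  obtain ⟨Rs, hRs⟩ := exists_hasR hlam
  obtain ⟨R1, hR1⟩ := substS_surjective hν (mulS Rs mν)
  have hR0 : R1 [] = 0 := by
    rw [← substS_nil R1 mν, hR1, mulS_nil, hRs.1, zero_mul]
  obtain ⟨m', hm'⟩ := exists_moments_hasR hR0
  exact ⟨m', hm'.nil_eq_one, R1, Rs, hm', hRs, congrFun hR1.symm⟩

lemma IsSubordS.left_unique {mν m1 m2 mlam : NCS d} (hν : mν [] = 1)
    (h1 : IsSubordS m1 mν mlam) (h2 : IsSubordS m2 mν mlam) : m1 = m2 := by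
  obtain ⟨R1, Rs, hR1, hRs, hmul⟩ := h1
  obtain ⟨R2, Rs', hR2, hRs', hmul'⟩ := h2
  obtain rfl := hRs.transform_unique hRs'
  obtain rfl := substS_injective hν ((funext hmul).symm.trans (funext hmul'))
  exact hR1.moments_unique hR2

end Subordination

/-- For unital linear functionals `μ, ν` on `ℂ⟨x₁,…,x_d⟩` with moment
series `mμ = 1 + M^μ`, `mν = 1 + M^ν`, the moment series `ms = 1 + M^{μ⊳ν}` of the
subordination distribution and `mc = 1 + M^{μ⊞ν}` of the free convolution satisfy
`1 + M^{μ⊞ν} = (1 + M^{μ⊳ν})·(1 + M^ν(z₁(1+M^{μ⊳ν}),…,z_d(1+M^{μ⊳ν})))`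
(note `substS mν ms = 1 + M^ν(z(1+M^{μ⊳ν}))`). Consequently, for fixed `ν`, the map
`μ ↦ μ ⊳ ν` is a bijection of `D_alg(d)` onto itself. -/
theorem stmt17
    (d : ℕ) (mμ mν ms mc : NCS d)
    (hμ : mμ [] = 1) (hν : mν [] = 1) (hs : ms [] = 1) (hc : mc [] = 1)
    (hsub : IsSubordS mμ mν ms) (hconv : IsFreeConvS mμ mν mc) :
    (∀ w, mc w = mulS ms (substS mν ms) w) ∧
    (∀ mlam : NCS d, mlam [] = 1 → ∃ m' : NCS d, m' [] = 1 ∧ IsSubordS m' mν mlam) ∧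
    (∀ m1 m2 mlam : NCS d, m1 [] = 1 → m2 [] = 1 →
      IsSubordS m1 mν mlam → IsSubordS m2 mν mlam → m1 = m2) := by
  exact ⟨congrFun (hsub.freeConv_eq hconv), fun _ hlam => exists_isSubordS hν hlam,
    fun _ _ _ _ _ h1 h2 => h1.left_unique hν h2⟩
end
end
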